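/- arXiv:math/0605453 — 2 statements merged into one kernel-verified Lean document; each statement's English description precedes it below -/
import Mathlib

section
/- For every γ ≥ 0, α > 0, β > 0 and x > 0, the integral in the definition of L^{(γ)} applied to the power function y ↦ y^β converges absolutely, and L^{(γ)}(y ↦ y^β)(x) = ψ_γ(β)·x^{β−α}, where ψ_γ(β) = ψ(β+γ) − ψ(γ). -/
open MeasureTheory Real Set Filter Topology

/-- The Laplace exponent of a spectrally negative infinitely divisible random variable. -/
noncomputable def psi (σ b : ℝ) (ν : Measure ℝ) (u : ℝ) : ℝ :=
  b * u + σ / 2 * u ^ 2 +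
    ∫ r in Ioi (0 : ℝ), (Real.exp (-u * r) - 1 + (if r ≤ 1 then u * r else 0)) ∂ν

/-- The Lamperti integro-differential operator `L^{(γ)}` associated to `ψ_γ` and index `α`. -/
noncomputable def Lop (σ b γ α : ℝ) (ν : Measure ℝ) (f : ℝ → ℝ) (x : ℝ) : ℝ :=
  x ^ (-α) * (σ / 2 * x ^ 2 * deriv (deriv f) x + (σ * γ + b + σ / 2) * x * deriv f x +
    ∫ r in Ioi (0 : ℝ),
      ((f (Real.exp (-r) * x) - f x) * Real.exp (-γ * r)
        + x * deriv f x * (if r ≤ 1 then r else 0)) ∂ν)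

theorem abs_exp_neg_sub_one_add_le_sq {t : ℝ} (ht : 0 ≤ t) :
    |Real.exp (-t) - 1 + t| ≤ t ^ 2 := by
  rcases le_total t 1 with h | h
  · have := Real.abs_exp_sub_one_sub_id_le (x := -t) (by rwa [abs_neg, abs_of_nonneg ht])
    simpa using this
  · have h1 : Real.exp (-t) ≤ 1 := Real.exp_le_one_iff.2 (by linarith)
    have h2 := Real.add_one_le_exp (-t)
    rw [abs_of_nonneg (by linarith)]
    nlinarith

theorem integrableOn_psi_integrand {ν : Measure ℝ}
    (hν : ∫⁻ r in Ioi (0 : ℝ), ENNReal.ofReal (min 1 (r ^ 2)) ∂ν < ⊤) {u : ℝ} (hu : 0 ≤ u) :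
    IntegrableOn (fun r => Real.exp (-u * r) - 1 + (if r ≤ 1 then u * r else 0)) (Ioi 0) ν := by
  have hmin : IntegrableOn (fun r : ℝ => min 1 (r ^ 2)) (Ioi 0) ν := by
    refine ⟨(by fun_prop : Measurable fun r : ℝ => min 1 (r ^ 2)).aestronglyMeasurable, ?_⟩
    rw [hasFiniteIntegral_iff_ofReal (Eventually.of_forall fun r => by positivity)]
    exact hν
  refine (hmin.const_mul (1 + u ^ 2)).mono' ?_ ?_
  · refine Measurable.aestronglyMeasurable ?_
    exact ((by fun_prop : Measurable fun r : ℝ => Real.exp (-u * r) - 1)).add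
      (Measurable.ite measurableSet_Iic (by fun_prop) measurable_const)
  · filter_upwards [ae_restrict_mem measurableSet_Ioi] with r (hr : 0 < r)
    rw [Real.norm_eq_abs]
    split_ifs with h
    · have hb := abs_exp_neg_sub_one_add_le_sq (mul_nonneg hu hr.le)
      rw [← neg_mul] at hb
      rw [min_eq_right (by nlinarith)]
      nlinarith [sq_nonneg r]
    · have h1 : Real.exp (-u * r) ≤ 1 := Real.exp_le_one_iff.2 (by nlinarith)
      have h2 := Real.exp_pos (-u * r)
      rw [min_eq_left (by nlinarith), abs_le]
      constructor <;> nlinarith [sq_nonneg u]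

/-- The operator `L^{(γ)}` maps the power function `y ↦ y^β` to `ψ_γ(β) x^{β-α}`, the integral
in its definition being absolutely convergent. -/
theorem Lop_rpow (σ b : ℝ) (ν : Measure ℝ)
    (hσ : 0 ≤ σ)
    (hν : ∫⁻ r in Ioi (0 : ℝ), ENNReal.ofReal (min 1 (r ^ 2)) ∂ν < ⊤)
    (hnd : 0 < σ ∨ ν (Ioi 0) ≠ 0 ∨ b ≠ 0)
    (γ α β x : ℝ) (hγ : 0 ≤ γ) (hα : 0 < α) (hβ : 0 < β) (hx : 0 < x) :
    IntegrableOn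
      (fun r => (((Real.exp (-r) * x) ^ β - x ^ β) * Real.exp (-γ * r)
        + x * deriv (fun y : ℝ => y ^ β) x * (if r ≤ 1 then r else 0))) (Ioi 0) ν ∧
    Lop σ b γ α ν (fun y : ℝ => y ^ β) x =
      (psi σ b ν (β + γ) - psi σ b ν γ) * x ^ (β - α) := by
  have hd : ∀ y : ℝ, 0 < y → deriv (fun y : ℝ => y ^ β) y = β * y ^ (β - 1) := fun y hy =>
    (Real.hasDerivAt_rpow_const (Or.inl hy.ne')).deriv
  have hdd : deriv (deriv fun y : ℝ => y ^ β) x = β * ((β - 1) * x ^ (β - 1 - 1)) := by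
    have he : deriv (fun y : ℝ => y ^ β) =ᶠ[𝓝 x] fun y => β * y ^ (β - 1) := by
      filter_upwards [lt_mem_nhds hx] with y hy using hd y hy
    rw [he.deriv_eq]
    exact ((Real.hasDerivAt_rpow_const (Or.inl hx.ne')).const_mul β).deriv
  have hx1 : x * x ^ (β - 1) = x ^ β := by
    rw [Real.rpow_sub_one hx.ne']
    field_simp
  have hx2 : x ^ 2 * x ^ (β - 1 - 1) = x ^ β := by
    rw [Real.rpow_sub_one hx.ne', Real.rpow_sub_one hx.ne']
    field_simp
  have hint : (fun r => ((Real.exp (-r) * x) ^ β - x ^ β) * Real.exp (-γ * r)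
        + x * deriv (fun y : ℝ => y ^ β) x * (if r ≤ 1 then r else 0)) =
      fun r => x ^ β * ((Real.exp (-(β + γ) * r) - 1 + (if r ≤ 1 then (β + γ) * r else 0)) -
        (Real.exp (-γ * r) - 1 + (if r ≤ 1 then γ * r else 0))) := by
    funext r
    rw [hd x hx, Real.mul_rpow (Real.exp_pos _).le hx.le, ← Real.exp_mul, mul_left_comm x β,
      hx1, show -(β + γ) * r = -r * β + -γ * r by ring, Real.exp_add]
    split_ifs <;> ring
  have hβγ := integrableOn_psi_integrand hν (add_nonneg hβ.le hγ)
  have hγi := integrableOn_psi_integrand hν hγ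
  refine ⟨?_, ?_⟩
  · rw [hint]
    exact (hβγ.sub hγi).const_mul _
  · simp only [Lop, psi]
    rw [hint, integral_const_mul, integral_sub hβγ hγi, hdd, hd x hx,
      show β - α = -α + β by ring, Real.rpow_add hx]
    linear_combination x ^ (-α) * (σ / 2 * β * (β - 1)) * hx2 +
      x ^ (-α) * ((σ * γ + b + σ / 2) * β) * hx1
end

section
/- (Theorem 2.2, asymptotic part.) Assume m < 0 and 0 < θ < α. Then there exists a constant C_θ ∈ (0,∞) such that I_{α,ψ}(x^α) ∼ C_θ · x^θ · I_{α,ψ_θ}(x^α) as x → ∞; that is, the ratio I_{α,ψ}(x^α) / (x^θ · I_{α,ψ_θ}(x^α)) converges to C_θ as x → ∞. -/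
open MeasureTheory Real Set Filter Topology

/-- The coefficients `a_n(ψ;α) = (∏_{k=1}^n ψ(αk))⁻¹`, with `a_0 = 1`. -/
noncomputable def coeffA (ψ : ℝ → ℝ) (α : ℝ) (n : ℕ) : ℝ :=
  (∏ k ∈ Finset.range n, ψ (α * (k + 1)))⁻¹

/-- The power series `I_{α,ψ}(x) = Σ_{n≥0} a_n(ψ;α) x^n`. -/
noncomputable def Iser (ψ : ℝ → ℝ) (α : ℝ) (x : ℝ) : ℝ :=
  ∑' n : ℕ, coeffA ψ α n * x ^ n


/-- The integrand of the jump part of `psi`. -/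
noncomputable def jumpIntegrand (u r : ℝ) : ℝ :=
  Real.exp (-u * r) - 1 + (if r ≤ 1 then u * r else 0)

lemma integrableOn_jumpIntegrand {ν : Measure ℝ}
    (hν : ∫⁻ r in Ioi (0 : ℝ), ENNReal.ofReal (min 1 (r ^ 2)) ∂ν < ⊤) {u : ℝ} (hu : 0 ≤ u) :
    IntegrableOn (jumpIntegrand u) (Ioi 0) ν := by
  have hmin : IntegrableOn (fun r : ℝ => min 1 (r ^ 2)) (Ioi 0) ν := by
    refine ⟨by fun_prop, ?_⟩
    rw [hasFiniteIntegral_iff_ofReal]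
    · exact hν
    · exact ae_of_all _ fun r => le_min zero_le_one (sq_nonneg r)
  refine Integrable.mono' (hmin.const_mul (1 + u ^ 2)) ?_ ?_
  · refine Measurable.aestronglyMeasurable ?_
    unfold jumpIntegrand
    refine Measurable.add (by fun_prop) ?_
    exact Measurable.ite measurableSet_Iic (by fun_prop) measurable_const
  · refine (ae_restrict_iff' measurableSet_Ioi).2 (ae_of_all _ fun r hr => ?_)
    have hr : 0 < r := hr
    have hur : 0 ≤ u * r := by positivity
    unfold jumpIntegrand
    rw [neg_mul, Real.norm_eq_abs]
    split_ifs with h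
    · have h1 := Real.add_one_le_exp (-(u * r))
      have hle : Real.exp (-(u * r)) ≤ 1 - u * r + (u * r) ^ 2 := by
        rcases le_or_gt (u * r) 1 with h2 | h2
        · have := (abs_le.1 (Real.abs_exp_sub_one_sub_id_le (x := -(u * r))
            (by rwa [abs_neg, abs_of_nonneg hur]))).2
          linarith [neg_sq (u * r)]
        · have : Real.exp (-(u * r)) ≤ 1 := Real.exp_le_one_iff.2 (by linarith)
          nlinarith
      rw [min_eq_right (by nlinarith), abs_of_nonneg (by linarith)]
      nlinarith [sq_nonneg r]
    · have h1 : Real.exp (-(u * r)) ≤ 1 := Real.exp_le_one_iff.2 (by linarith)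
      have h2 := Real.exp_pos (-(u * r))
      rw [min_eq_left (by nlinarith), abs_le]
      constructor <;> nlinarith [sq_nonneg u]

lemma psi_eq (σ b : ℝ) (ν : Measure ℝ) (u : ℝ) :
    psi σ b ν u = b * u + σ / 2 * u ^ 2 + ∫ r in Ioi (0 : ℝ), jumpIntegrand u r ∂ν := rfl

lemma jumpIntegrand_div_lt {u v r : ℝ} (hu : 0 < u) (huv : u < v) (hr : 0 < r) :
    jumpIntegrand u r / u < jumpIntegrand v r / v := by
  have hv : 0 < v := hu.trans huv
  have key : Real.exp (-u * r) < (1 - u / v) + u / v * Real.exp (-v * r) := by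
    have h := strictConvexOn_exp.2 (mem_univ 0) (mem_univ (-v * r)) (by nlinarith)
      (sub_pos.2 ((div_lt_one hv).2 huv)) (div_pos hu hv) (by ring)
    simp only [smul_eq_mul, mul_zero, zero_add, Real.exp_zero, mul_one] at h
    rwa [show u / v * (-v * r) = -u * r by field_simp] at h
  have key2 : v * (Real.exp (-u * r) - 1) < u * (Real.exp (-v * r) - 1) := by
    have := mul_lt_mul_of_pos_left key hv
    have e : v * ((1 - u / v) + u / v * Real.exp (-v * r)) = v - u + u * Real.exp (-v * r) := by
      field_simp
    linarith
  unfold jumpIntegrand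
  rw [div_lt_div_iff₀ hu hv]
  split_ifs <;> nlinarith

lemma psi_div_lt {σ b : ℝ} {ν : Measure ℝ} (hσ : 0 ≤ σ)
    (hν : ∫⁻ r in Ioi (0 : ℝ), ENNReal.ofReal (min 1 (r ^ 2)) ∂ν < ⊤)
    (hnd : 0 < σ ∨ ν (Ioi 0) ≠ 0) {u v : ℝ} (hu : 0 < u) (huv : u < v) :
    psi σ b ν u / u < psi σ b ν v / v := by
  have hv : 0 < v := hu.trans huv
  have hiu := (integrableOn_jumpIntegrand hν hu.le).div_const u
  have hiv := (integrableOn_jumpIntegrand hν hv.le).div_const v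
  have hdiff : psi σ b ν v / v - psi σ b ν u / u = σ / 2 * (v - u) +
      ∫ r in Ioi (0 : ℝ), (jumpIntegrand v r / v - jumpIntegrand u r / u) ∂ν := by
    rw [integral_sub hiv hiu, integral_div, integral_div, psi_eq, psi_eq]
    field_simp
    ring
  have hnn : ∀ r ∈ Ioi (0 : ℝ), 0 < jumpIntegrand v r / v - jumpIntegrand u r / u :=
    fun r hr => sub_pos.2 (jumpIntegrand_div_lt hu huv hr)
  have hint : 0 ≤ ∫ r in Ioi (0 : ℝ), (jumpIntegrand v r / v - jumpIntegrand u r / u) ∂ν :=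
    setIntegral_nonneg measurableSet_Ioi fun r hr => (hnn r hr).le
  rw [← sub_pos, hdiff]
  rcases hnd with h | h
  · have : 0 < σ / 2 * (v - u) := mul_pos (by linarith) (sub_pos.2 huv)
    linarith
  · have h1 : 0 ≤ σ / 2 * (v - u) := mul_nonneg (by linarith) (sub_pos.2 huv).le
    have h2 : 0 < ∫ r in Ioi (0 : ℝ), (jumpIntegrand v r / v - jumpIntegrand u r / u) ∂ν := by
      rw [setIntegral_pos_iff_support_of_nonneg_ae]
      · refine (pos_iff_ne_zero.2 h).trans_le (measure_mono fun r hr => ⟨?_, hr⟩)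
        exact (hnn r hr).ne'
      · exact (ae_restrict_iff' measurableSet_Ioi).2 (ae_of_all _ fun r hr => (hnn r hr).le)
      · exact hiv.sub hiu
    linarith

lemma slope_exp_eq_integral {θ u : ℝ} (hu : θ < u) (r : ℝ) :
    (Real.exp (-u * r) - Real.exp (-θ * r)) / (u - θ) =
      -(r * ∫ t in (0 : ℝ)..1, Real.exp (-(θ + t * (u - θ)) * r)) := by
  have hd : u - θ ≠ 0 := (sub_pos.2 hu).ne'
  have h := intervalIntegral.integral_eq_sub_of_hasDerivAt (a := 0) (b := 1)
    (f := fun t => Real.exp (-(θ + t * (u - θ)) * r))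
    (f' := fun t => Real.exp (-(θ + t * (u - θ)) * r) * (-(u - θ) * r))
    (fun t _ => by
      have h1 : HasDerivAt (fun t : ℝ => -(θ + t * (u - θ)) * r) (-(u - θ) * r) t := by
        simpa using (((hasDerivAt_id t).mul_const (u - θ)).const_add θ).neg.mul_const r
      exact h1.exp)
    (Continuous.intervalIntegrable (by fun_prop) _ _)
  rw [intervalIntegral.integral_mul_const] at h
  rw [div_eq_iff hd]
  simp only [zero_mul, add_zero, one_mul, add_sub_cancel] at h
  linarith

lemma concaveOn_slope_jumpIntegrand (θ : ℝ) {r : ℝ} (hr : 0 < r) :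
    ConcaveOn ℝ (Ioi θ) fun u => (jumpIntegrand u r - jumpIntegrand θ r) / (u - θ) := by
  have hconv : ConvexOn ℝ (Ioi θ)
      fun u => ∫ t in (0 : ℝ)..1, Real.exp (-(θ + t * (u - θ)) * r) := by
    refine ⟨convex_Ioi θ, fun u _ v _ a c ha hc hac => ?_⟩
    simp only [smul_eq_mul]
    rw [← intervalIntegral.integral_const_mul, ← intervalIntegral.integral_const_mul,
      ← intervalIntegral.integral_add (Continuous.intervalIntegrable (by fun_prop) _ _)
        (Continuous.intervalIntegrable (by fun_prop) _ _)]
    refine intervalIntegral.integral_mono_on zero_le_one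
      (Continuous.intervalIntegrable (by fun_prop) _ _)
      (Continuous.intervalIntegrable (by fun_prop) _ _) fun t _ => ?_
    have h := convexOn_exp.2 (mem_univ (-(θ + t * (u - θ)) * r))
      (mem_univ (-(θ + t * (v - θ)) * r)) ha hc hac
    simp only [smul_eq_mul] at h
    have e : -(θ + t * (a * u + c * v - θ)) * r =
        a * (-(θ + t * (u - θ)) * r) + c * (-(θ + t * (v - θ)) * r) := by
      obtain rfl : c = 1 - a := by linarith
      ring
    rwa [e]
  have h := ((hconv.smul hr.le).neg).add_const (if r ≤ 1 then r else 0)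
  refine h.congr fun u hu => ?_
  have hd : u - θ ≠ 0 := (sub_pos.2 hu).ne'
  have e := slope_exp_eq_integral hu r
  simp only [Pi.add_apply, Pi.neg_apply, smul_eq_mul]
  rw [← e]
  unfold jumpIntegrand
  split_ifs
  · field_simp
    ring
  · ring

lemma concaveOn_psi_div {σ b : ℝ} {ν : Measure ℝ}
    (hν : ∫⁻ r in Ioi (0 : ℝ), ENNReal.ofReal (min 1 (r ^ 2)) ∂ν < ⊤)
    {θ : ℝ} (hθ : 0 < θ) (hroot : psi σ b ν θ = 0) :
    ConcaveOn ℝ (Ioi θ) fun u => psi σ b ν u / (u - θ) := by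
  have hi : ∀ u ∈ Ioi θ, IntegrableOn
      (fun r => (jumpIntegrand u r - jumpIntegrand θ r) / (u - θ)) (Ioi 0) ν := fun u hu =>
    ((integrableOn_jumpIntegrand hν (hθ.trans hu).le).sub
      (integrableOn_jumpIntegrand hν hθ.le)).div_const _
  have hrep : ∀ u ∈ Ioi θ, psi σ b ν u / (u - θ) = b + σ / 2 * (u + θ) +
      ∫ r in Ioi (0 : ℝ), (jumpIntegrand u r - jumpIntegrand θ r) / (u - θ) ∂ν := by
    intro u hu
    have hd : u - θ ≠ 0 := (sub_pos.2 hu).ne'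
    have hr := hroot
    rw [integral_div, integral_sub (integrableOn_jumpIntegrand hν (hθ.trans hu).le)
      (integrableOn_jumpIntegrand hν hθ.le), psi_eq]
    rw [psi_eq] at hr
    field_simp
    linarith
  refine ⟨convex_Ioi θ, fun u hu v hv a c ha hc hac => ?_⟩
  have hw : a • u + c • v ∈ Ioi θ := convex_Ioi θ hu hv ha hc hac
  have hmono : a * ∫ r in Ioi (0 : ℝ), (jumpIntegrand u r - jumpIntegrand θ r) / (u - θ) ∂ν +
      c * ∫ r in Ioi (0 : ℝ), (jumpIntegrand v r - jumpIntegrand θ r) / (v - θ) ∂ν ≤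
      ∫ r in Ioi (0 : ℝ),
        (jumpIntegrand (a • u + c • v) r - jumpIntegrand θ r) / (a • u + c • v - θ) ∂ν := by
    rw [← integral_const_mul, ← integral_const_mul,
      ← integral_add ((hi u hu).const_mul a) ((hi v hv).const_mul c)]
    exact setIntegral_mono_on (((hi u hu).const_mul a).add ((hi v hv).const_mul c)) (hi _ hw)
      measurableSet_Ioi fun r hr => (concaveOn_slope_jumpIntegrand θ hr).2 hu hv ha hc hac
  beta_reduce
  rw [hrep u hu, hrep v hv, hrep _ hw]
  simp only [smul_eq_mul] at hmono ⊢
  obtain rfl : c = 1 - a := by linarith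
  linarith

lemma abs_rpow_sub_one_le {t δ : ℝ} (ht : 0 ≤ t) (hδ0 : 0 < δ) (hδ1 : δ ≤ 1) :
    |t ^ δ - 1| ≤ |t - 1| := by
  rcases le_total t 1 with h | h
  · have h1 : t ^ δ ≤ 1 := Real.rpow_le_one ht h hδ0.le
    have h2 : t ≤ t ^ δ := Real.self_le_rpow_of_le_one ht h hδ1
    rw [abs_of_nonpos (by linarith), abs_of_nonpos (by linarith)]
    linarith
  · have h1 : 1 ≤ t ^ δ := Real.one_le_rpow h hδ0.le
    have h2 : t ^ δ ≤ t := Real.rpow_le_self_of_one_le h hδ1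
    rw [abs_of_nonneg (by linarith), abs_of_nonneg (by linarith)]
    linarith

lemma exists_forall_le_add_const {f g : ℕ → ℝ} (hg : ∀ n, 0 ≤ g n) (h : ∀ᶠ n in atTop, f n ≤ g n) :
    ∃ K, 0 ≤ K ∧ ∀ n, f n ≤ g n + K := by
  obtain ⟨N, hN⟩ := eventually_atTop.1 h
  refine ⟨∑ k ∈ Finset.range N, |f k|, Finset.sum_nonneg fun _ _ => abs_nonneg _, fun n => ?_⟩
  rcases lt_or_ge n N with hn | hn
  · have := Finset.single_le_sum (f := fun k => |f k|) (fun _ _ => abs_nonneg _)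
      (Finset.mem_range.2 hn)
    linarith [le_abs_self (f n), hg n]
  · linarith [hN n hn, Finset.sum_nonneg (s := Finset.range N) (f := fun k => |f k|)
      fun _ _ => abs_nonneg _]

/-- Abelian comparison of two power series. The weights `q n * y ^ n` concentrate where
`T n` is close to `y`, by a second moment estimate. -/
theorem tendsto_powerSeries_ratio {T p q : ℕ → ℝ} {C δ : ℝ} (hT0 : T 0 = 0)
    (hTpos : ∀ n, 0 < T (n + 1)) (hTtop : Tendsto T atTop atTop)
    (hTslow : ∀ ε > 0, ∀ᶠ n in atTop, T (n + 1) ≤ (1 + ε) * T n)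
    (hqpos : ∀ n, 0 < q n) (hq : ∀ n, q (n + 1) * T (n + 1) = q n)
    (hδ0 : 0 < δ) (hδ1 : δ ≤ 1) (hC : 0 ≤ C)
    (hp : Tendsto (fun n => p n / (q n * T n ^ δ)) atTop (𝓝 C)) :
    Tendsto (fun y : ℝ => (∑' n, p n * y ^ n) / (y ^ δ * ∑' n, q n * y ^ n)) atTop (𝓝 C) := by
  have hTnn : ∀ n, 0 ≤ T n := fun n => by
    cases n with
    | zero => exact hT0.ge
    | succ n => exact (hTpos n).le
  have hsQ : ∀ y > 0, Summable fun n => q n * y ^ n := by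
    intro y hy
    refine summable_of_ratio_test_tendsto_lt_one (l := 0) one_pos
      (Eventually.of_forall fun n => (mul_pos (hqpos n) (pow_pos hy n)).ne') ?_
    have h1 : Tendsto (fun n => y / T (n + 1)) atTop (𝓝 0) :=
      ((tendsto_add_atTop_iff_nat 1).2 hTtop).const_div_atTop y
    refine h1.congr fun n => ?_
    have := hqpos (n + 1)
    have := hTpos n
    rw [Real.norm_of_nonneg (by positivity),
      Real.norm_of_nonneg (mul_pos (hqpos n) (pow_pos hy n)).le, ← hq n]
    field_simp
    ring
  have hQpos : ∀ y > 0, 0 < ∑' n, q n * y ^ n := fun y hy =>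
    (hsQ y hy).tsum_pos (fun n => (mul_pos (hqpos n) (pow_pos hy n)).le) 0 (by simpa using hqpos 0)
  have hsum1 : ∀ y > 0, HasSum (fun n => q n * y ^ n * T n) (y * ∑' n, q n * y ^ n) := by
    intro y hy
    rw [← hasSum_nat_add_iff' 1]
    simp only [Finset.range_one, Finset.sum_singleton, hT0, mul_zero, sub_zero]
    refine ((hsQ y hy).hasSum.mul_left y).congr_fun fun n => ?_
    rw [← hq n]
    ring
  have hsum2 : ∀ y > 0, HasSum (fun n => q n * y ^ n * (T n * T (n - 1)))
      (y ^ 2 * ∑' n, q n * y ^ n) := by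
    intro y hy
    rw [← hasSum_nat_add_iff' 2]
    simp only [Finset.sum_range_succ, Finset.range_zero, Finset.sum_empty, hT0, mul_zero,
      sub_zero, Nat.sub_self, add_zero, Nat.zero_sub]
    refine ((hsQ y hy).hasSum.mul_left (y ^ 2)).congr_fun fun n => ?_
    rw [← hq n, ← hq (n + 1)]
    simp only [Nat.add_succ_sub_one]
    ring
  have hvar : ∀ ε > 0, ∃ K, 0 ≤ K ∧ ∀ n, T n ^ 2 ≤ (1 + ε) * (T n * T (n - 1)) + K := by
    intro ε hε
    refine exists_forall_le_add_const
      (fun n => mul_nonneg (by linarith) (mul_nonneg (hTnn _) (hTnn _))) ?_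
    filter_upwards [(tendsto_sub_atTop_nat 1).eventually (hTslow ε hε), eventually_ge_atTop 1]
      with n hn hn1
    rw [Nat.sub_add_cancel hn1] at hn
    nlinarith [mul_le_mul_of_nonneg_left hn (hTnn n)]
  have happrox : ∀ ε > 0, ∃ K, 0 ≤ K ∧ ∀ n, |p n / q n - C * T n ^ δ| ≤ ε * T n ^ δ + K := by
    intro ε hε
    refine exists_forall_le_add_const
      (fun n => mul_nonneg hε.le (Real.rpow_nonneg (hTnn _) _)) ?_
    filter_upwards [hp.eventually (Metric.closedBall_mem_nhds C hε),
      hTtop.eventually_gt_atTop 0] with n hn hTn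
    have hTd : 0 < T n ^ δ := Real.rpow_pos_of_pos hTn δ
    have hqn := hqpos n
    rw [Real.dist_eq] at hn
    have e : p n / q n - C * T n ^ δ = (p n / (q n * T n ^ δ) - C) * T n ^ δ := by
      field_simp
    rw [e, abs_mul, abs_of_pos hTd]
    exact mul_le_mul_of_nonneg_right hn hTd.le
  have hmain : ∀ s > 0, ∃ K₁ K₂ : ℝ, ∀ y > 0,
      |(∑' n, p n * y ^ n) / (y ^ δ * ∑' n, q n * y ^ n) - C| ≤
        s + (s + C) * (s + (s ^ 2 + K₂ / y ^ 2) / s) + K₁ / y ^ δ := by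
    intro s hs
    obtain ⟨K₁, -, h₁⟩ := happrox s hs
    obtain ⟨K₂, -, h₂⟩ := hvar (s ^ 2) (by positivity)
    refine ⟨K₁, K₂, fun y hy => ?_⟩
    set Q := ∑' n, q n * y ^ n with hQdef
    have hQ : 0 < Q := hQpos y hy
    have hyd : 0 < y ^ δ := Real.rpow_pos_of_pos hy δ
    have hbound : HasSum (fun n => q n * y ^ n * (y ^ δ * (s + (s + C) * (s +
        ((1 + s ^ 2) * (T n * T (n - 1)) / y ^ 2 + K₂ / y ^ 2 - 2 * (T n / y) + 1) / s)) + K₁))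
        (Q * (y ^ δ * (s + (s + C) * (s + (s ^ 2 + K₂ / y ^ 2) / s)) + K₁)) := by
      have h := (((hsum2 y hy).mul_left (y ^ δ * ((s + C) * ((1 + s ^ 2) / y ^ 2 / s)))).add
        ((hsum1 y hy).mul_left (-(y ^ δ * ((s + C) * (2 / y / s)))))).add
        ((hsQ y hy).hasSum.mul_left
          (y ^ δ * (s + (s + C) * (s + (K₂ / y ^ 2 + 1) / s)) + K₁))
      rw [← hQdef] at h
      have e : Q * (y ^ δ * (s + (s + C) * (s + (s ^ 2 + K₂ / y ^ 2) / s)) + K₁) =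
          y ^ δ * ((s + C) * ((1 + s ^ 2) / y ^ 2 / s)) * (y ^ 2 * Q) +
            -(y ^ δ * ((s + C) * (2 / y / s))) * (y * Q) +
            (y ^ δ * (s + (s + C) * (s + (K₂ / y ^ 2 + 1) / s)) + K₁) * Q := by
        field_simp
        ring
      rw [e]
      refine h.congr_fun fun n => ?_
      field_simp
      ring
    have hpt : ∀ n, ‖p n * y ^ n - C * y ^ δ * (q n * y ^ n)‖ ≤ q n * y ^ n * (y ^ δ * (s +
        (s + C) * (s + ((1 + s ^ 2) * (T n * T (n - 1)) / y ^ 2 + K₂ / y ^ 2 -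
          2 * (T n / y) + 1) / s)) + K₁) := by
      intro n
      have hqn := hqpos n
      have hw : 0 < q n * y ^ n := mul_pos hqn (pow_pos hy n)
      have e : p n * y ^ n - C * y ^ δ * (q n * y ^ n) =
          q n * y ^ n * (p n / q n - C * y ^ δ) := by
        field_simp
      rw [e, norm_mul, Real.norm_of_nonneg hw.le, Real.norm_eq_abs]
      refine mul_le_mul_of_nonneg_left ?_ hw.le
      set t := T n / y with ht
      have htnn : 0 ≤ t := div_nonneg (hTnn n) hy.le
      have hTt : T n ^ δ = y ^ δ * t ^ δ := by
        rw [← Real.mul_rpow hy.le htnn, ht, mul_div_cancel₀ _ hy.ne']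
      have htd := abs_rpow_sub_one_le htnn hδ0 hδ1
      have htd' : t ^ δ ≤ 1 + |t - 1| := by linarith [le_abs_self (t ^ δ - 1)]
      have hsq : (t - 1) ^ 2 ≤
          (1 + s ^ 2) * (T n * T (n - 1)) / y ^ 2 + K₂ / y ^ 2 - 2 * t + 1 := by
        have : t ^ 2 ≤ ((1 + s ^ 2) * (T n * T (n - 1)) + K₂) / y ^ 2 := by
          rw [ht, div_pow]
          exact div_le_div_of_nonneg_right (h₂ n) (by positivity)
        rw [add_div] at this
        linarith
      have hamgm : |t - 1| ≤ s + (t - 1) ^ 2 / s := by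
        rw [← sub_le_iff_le_add', le_div_iff₀ hs, ← sq_abs (t - 1)]
        nlinarith [sq_nonneg (|t - 1| - s), abs_nonneg (t - 1)]
      have habs := hamgm.trans (add_le_add_right (div_le_div_of_nonneg_right hsq hs.le) s)
      have htri : |p n / q n - C * y ^ δ| ≤
          |p n / q n - C * T n ^ δ| + C * y ^ δ * |t ^ δ - 1| := by
        have e2 : p n / q n - C * y ^ δ =
            (p n / q n - C * T n ^ δ) + C * y ^ δ * (t ^ δ - 1) := by
          rw [hTt]
          ring
        rw [e2]
        refine (abs_add_le _ _).trans_eq ?_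
        rw [abs_mul (C * y ^ δ), abs_of_nonneg (mul_nonneg hC hyd.le)]
      calc |p n / q n - C * y ^ δ|
          ≤ (s * T n ^ δ + K₁) + C * y ^ δ * |t - 1| :=
            htri.trans (add_le_add (h₁ n) (mul_le_mul_of_nonneg_left htd (by positivity)))
        _ ≤ (s * (y ^ δ * (1 + |t - 1|)) + K₁) + C * y ^ δ * |t - 1| := by
            rw [hTt]
            gcongr
        _ = y ^ δ * (s + (s + C) * |t - 1|) + K₁ := by ring
        _ ≤ _ := by gcongr
    have hsp : Summable fun n => p n * y ^ n := by
      have h := (Summable.of_norm_bounded hbound.summable hpt).add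
        ((hsQ y hy).mul_left (C * y ^ δ))
      simpa using h
    have hle := tsum_of_norm_bounded hbound hpt
    rw [hsp.tsum_sub ((hsQ y hy).mul_left _), tsum_mul_left, ← hQdef, Real.norm_eq_abs] at hle
    have e : (∑' n, p n * y ^ n) / (y ^ δ * Q) - C =
        ((∑' n, p n * y ^ n) - C * y ^ δ * Q) / (y ^ δ * Q) := by
      field_simp
    rw [e, abs_div, abs_of_pos (mul_pos hyd hQ), div_le_iff₀ (mul_pos hyd hQ)]
    refine hle.trans_eq ?_
    field_simp
  rw [Metric.tendsto_nhds]
  intro η hη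
  set s := min 1 (η / (4 + 2 * C)) with hs
  have hs0 : 0 < s := lt_min one_pos (by positivity)
  have hs1 : s ≤ 1 := min_le_left _ _
  have hsη : s * (4 + 2 * C) ≤ η := (le_div_iff₀ (by positivity)).1 (min_le_right _ _)
  obtain ⟨K₁, K₂, hK⟩ := hmain s hs0
  have hlim : Tendsto (fun y : ℝ => s + (s + C) * (s + (s ^ 2 + K₂ / y ^ 2) / s) + K₁ / y ^ δ)
      atTop (𝓝 (s + (s + C) * (s + (s ^ 2 + 0) / s) + 0)) :=
    (((((((tendsto_pow_atTop two_ne_zero).const_div_atTop K₂).const_add _).div_const s).const_add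
      s).const_mul (s + C)).const_add s).add ((tendsto_rpow_atTop hδ0).const_div_atTop K₁)
  have hlt : s + (s + C) * (s + (s ^ 2 + 0) / s) + 0 < η := by
    have : (s ^ 2 + 0) / s = s := by field_simp; ring
    rw [this]
    nlinarith
  filter_upwards [hlim.eventually (gt_mem_nhds hlt), eventually_gt_atTop 0] with y hy hy0
  exact (hK y hy0).trans_lt hy

lemma coeffA_succ (ψ : ℝ → ℝ) (α : ℝ) (n : ℕ) :
    coeffA ψ α (n + 1) = coeffA ψ α n * (ψ (α * (n + 1)))⁻¹ := by
  unfold coeffA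
  rw [Finset.prod_range_succ, mul_inv]

lemma coeffA_pos {ψ : ℝ → ℝ} {α : ℝ} (h : ∀ n : ℕ, 0 < ψ (α * (n + 1))) (n : ℕ) :
    0 < coeffA ψ α n :=
  inv_pos.2 (Finset.prod_pos fun k _ => h k)

/-- A Bohr–Mollerup type limit for log-concave increasing functions. -/
lemma exists_tendsto_coeffA_ratio {F : ℝ → ℝ} {α θ : ℝ} (hθ : 0 < θ) (hθα : θ < α)
    (hpos : ∀ u ∈ Ioi θ, 0 < F u) (hmono : MonotoneOn F (Ioi θ))
    (hlog : ConcaveOn ℝ (Ioi θ) fun u => Real.log (F u)) :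
    ∃ C, 0 < C ∧ Tendsto (fun n : ℕ => coeffA F α n /
      (coeffA (fun u => F (u + θ)) α n * F (α * n + θ) ^ (θ / α))) atTop (𝓝 C) := by
  have hα : 0 < α := hθ.trans hθα
  have hd0 : 0 < θ / α := div_pos hθ hα
  have hd1 : θ / α < 1 := (div_lt_one hα).2 hθα
  have hdα : θ / α * α = θ := div_mul_cancel₀ _ hα.ne'
  set d := θ / α with hd
  have hmem : ∀ n : ℕ, α * (n + 1) ∈ Ioi θ := fun n => by
    have : 0 ≤ α * n := by positivity
    show θ < _
    linarith
  have hmem' : ∀ n : ℕ, α * (n + 1) + θ ∈ Ioi θ := fun n => by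
    have := hmem n
    show θ < _
    linarith [mem_Ioi.1 this]
  have hp := coeffA_pos fun n => hpos _ (hmem n)
  have hq := coeffA_pos (ψ := fun u => F (u + θ)) fun n => hpos _ (hmem' n)
  set r : ℕ → ℝ := fun n =>
    Real.log (coeffA F α (n + 1)) - Real.log (coeffA (fun u => F (u + θ)) α (n + 1)) with hr
  have hrsucc : ∀ n : ℕ, r (n + 1) = r n + Real.log (F (α * (n + 1 + 1) + θ)) -
      Real.log (F (α * (n + 1 + 1))) := fun n => by
    have h1 := hpos _ (hmem (n + 1))
    have h2 := hpos _ (hmem' (n + 1))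
    push_cast at h1 h2
    simp only [hr]
    rw [coeffA_succ F, coeffA_succ (fun u => F (u + θ)),
      Real.log_mul (hp _).ne' (by push_cast; exact (inv_pos.2 h1).ne'),
      Real.log_mul (hq _).ne' (by push_cast; exact (inv_pos.2 h2).ne'), Real.log_inv, Real.log_inv]
    push_cast
    ring
  set e : ℕ → ℝ := fun n => r n - d * Real.log (F (α * (n + 1) + θ)) with he
  set e' : ℕ → ℝ := fun n => r n - d * Real.log (F (α * (n + 1 + 1))) with he'
  have hanti : Antitone e := antitone_nat_of_succ_le fun n => by
    have h := hlog.2 (hmem' (n + 1)) (hmem' n) (sub_pos.2 hd1).le hd0.le (by ring)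
    have hx : (1 - d) * (α * ((n + 1 : ℕ) + 1) + θ) + d * (α * (n + 1) + θ) =
        α * (n + 1 + 1) := by
      push_cast
      linear_combination (-1 : ℝ) * hdα
    simp only [smul_eq_mul] at h
    rw [hx] at h
    simp only [he, hrsucc]
    push_cast at h ⊢
    linarith
  have hmono' : Monotone e' := monotone_nat_of_le_succ fun n => by
    have h := hlog.2 (hmem (n + 1)) (hmem (n + 2)) (sub_pos.2 hd1).le hd0.le (by ring)
    have hx : (1 - d) * (α * ((n + 1 : ℕ) + 1)) + d * (α * ((n + 2 : ℕ) + 1)) =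
        α * (n + 1 + 1) + θ := by
      push_cast
      linear_combination hdα
    simp only [smul_eq_mul] at h
    rw [hx] at h
    simp only [he', hrsucc]
    push_cast at h ⊢
    rw [show (n : ℝ) + 2 + 1 = n + 1 + 1 + 1 by ring] at h
    linarith
  have hle : ∀ n, e' n ≤ e n := fun n => by
    have h0 := hmem (n + 1)
    push_cast at h0
    have h := Real.log_le_log (hpos _ (hmem' n)) (hmono (hmem' n) h0 (by linarith))
    simp only [he, he']
    nlinarith
  have hlim := tendsto_atTop_ciInf hanti
    ⟨e' 0, by rintro _ ⟨n, rfl⟩; exact (hmono' n.zero_le).trans (hle n)⟩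
  refine ⟨Real.exp (⨅ n, e n), Real.exp_pos _, ?_⟩
  rw [← tendsto_add_atTop_iff_nat 1]
  refine ((Real.continuous_exp.tendsto _).comp hlim).congr fun n => ?_
  have hF := hpos _ (hmem' n)
  simp only [Function.comp_apply, he, hr]
  rw [Real.exp_sub, Real.exp_sub, Real.exp_log (hp _), Real.exp_log (hq _), div_div,
    Real.rpow_def_of_pos (by push_cast; exact hF)]
  push_cast
  rw [mul_comm d]

/-- Theorem 2.2, asymptotic part: for `m < 0` and `0 < θ < α`, there is a constant
`C_θ ∈ (0,∞)` such that `I_{α,ψ}(x^α) ∼ C_θ x^θ I_{α,ψ_θ}(x^α)` as `x → ∞`. -/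
theorem Ifun_asymptotic (σ b : ℝ) (ν : Measure ℝ)
    (hσ : 0 ≤ σ)
    (hν : ∫⁻ r in Ioi (0 : ℝ), ENNReal.ofReal (min 1 (r ^ 2)) ∂ν < ⊤)
    (hnd : 0 < σ ∨ ν (Ioi 0) ≠ 0 ∨ b ≠ 0)
    (hns : 0 < σ ∨ ¬ IntegrableOn (fun r => r) (Ioc 0 1) ν ∨
      0 < b - ∫ r in Ioc (0 : ℝ) 1, r ∂ν)
    (hm : ¬ IntegrableOn (fun r => r) (Ioi 1) ν ∨ b - ∫ r in Ioi (1 : ℝ), r ∂ν < 0)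
    (α θ : ℝ) (hθpos : 0 < θ) (hθα : θ < α)
    (hθroot : psi σ b ν θ = 0) :
    ∃ C : ℝ, 0 < C ∧
      Tendsto (fun x : ℝ =>
          Iser (psi σ b ν) α (x ^ α) /
            (x ^ θ * Iser (fun u => psi σ b ν (u + θ) - psi σ b ν θ) α (x ^ α)))
        atTop (𝓝 C) := by
  have hα : 0 < α := hθpos.trans hθα
  have hnd' : 0 < σ ∨ ν (Ioi 0) ≠ 0 := by
    by_contra! h
    obtain rfl : σ = 0 := le_antisymm h.1 hσ
    have hb : b ≠ 0 := by simpa [h.2] using hnd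
    rw [psi_eq, Measure.restrict_eq_zero.2 h.2] at hθroot
    simp [hb, hθpos.ne'] at hθroot
  have hlt : ∀ u v, 0 < u → u < v → psi σ b ν u / u < psi σ b ν v / v :=
    fun u v => psi_div_lt hσ hν hnd'
  have hconc := concaveOn_psi_div hν hθpos hθroot
  simp only [hθroot, sub_zero]
  set F := psi σ b ν with hF
  have hpos : ∀ u ∈ Ioi θ, 0 < F u := fun u hu => by
    have h := hlt θ u hθpos hu
    rw [hθroot, zero_div] at h
    exact (div_pos_iff_of_pos_right (hθpos.trans hu)).1 h
  have hmono : MonotoneOn F (Ioi θ) := by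
    intro u hu v hv huv
    rcases huv.eq_or_lt with rfl | huv
    · exact le_rfl
    have hu0 : 0 < u := hθpos.trans hu
    have h := hlt u v hu0 huv
    rw [div_lt_div_iff₀ hu0 (hu0.trans huv)] at h
    nlinarith [hpos u hu]
  have hφpos : ∀ u ∈ Ioi θ, 0 < F u / (u - θ) := fun u hu => div_pos (hpos u hu) (sub_pos.2 hu)
  have hlog : ConcaveOn ℝ (Ioi θ) fun u => Real.log (F u) := by
    have h1 : ConcaveOn ℝ (Ioi θ) fun u => Real.log (F u / (u - θ)) := by
      refine ⟨convex_Ioi θ, fun u hu v hv a c ha hc hac => ?_⟩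
      refine (strictConcaveOn_log_Ioi.concaveOn.2 (hφpos u hu) (hφpos v hv) ha hc hac).trans ?_
      refine Real.log_le_log ?_ (hconc.2 hu hv ha hc hac)
      exact convex_Ioi (0 : ℝ) (hφpos u hu) (hφpos v hv) ha hc hac
    have h2 : ConcaveOn ℝ (Ioi θ) fun u => Real.log (u - θ) := by
      refine ⟨convex_Ioi θ, fun u hu v hv a c ha hc hac => ?_⟩
      refine (strictConcaveOn_log_Ioi.concaveOn.2 (mem_Ioi.2 (sub_pos.2 hu))
        (mem_Ioi.2 (sub_pos.2 hv)) ha hc hac).trans_eq ?_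
      obtain rfl : c = 1 - a := by linarith
      simp only [smul_eq_mul]
      congr 1
      ring
    refine (h1.add h2).congr fun u hu => ?_
    rw [Pi.add_apply, ← Real.log_mul (hφpos u hu).ne' (sub_pos.2 hu).ne',
      div_mul_cancel₀ _ (sub_pos.2 hu).ne']
  obtain ⟨C, hC, hlim⟩ := exists_tendsto_coeffA_ratio hθpos hθα hpos hmono hlog
  refine ⟨C, hC, ?_⟩
  have hmem : ∀ n : ℕ, α * (n + 1) + θ ∈ Ioi θ := fun n => by
    have : 0 < α * ((n : ℝ) + 1) := by positivity
    show θ < _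
    linarith
  have hTpos : ∀ n : ℕ, 0 < F (α * ((n + 1 : ℕ) : ℝ) + θ) := fun n => by
    push_cast
    exact hpos _ (hmem n)
  have htop : Tendsto (fun n : ℕ => F (α * n + θ)) atTop atTop := by
    have hc : 0 < F α / α := div_pos (hpos α hθα) hα
    refine tendsto_atTop_mono' atTop ?_
      (tendsto_natCast_atTop_atTop.const_mul_atTop (mul_pos hc hα))
    filter_upwards [eventually_ge_atTop 1] with n hn
    have hn' : (1 : ℝ) ≤ n := by exact_mod_cast hn
    have h1 : α < α * n + θ := by nlinarith
    have h := (lt_div_iff₀ (hα.trans h1)).1 (hlt α _ hα h1)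
    nlinarith
  have hslow : ∀ ε > 0, ∀ᶠ n : ℕ in atTop,
      F (α * ((n + 1 : ℕ) : ℝ) + θ) ≤ (1 + ε) * F (α * n + θ) := by
    intro ε hε
    filter_upwards [eventually_ge_atTop 2,
      tendsto_natCast_atTop_atTop.eventually_ge_atTop (1 + 2 / ε)] with n hn hnε
    have hn' : (2 : ℝ) ≤ n := by exact_mod_cast hn
    have hn0 : (0 : ℝ) < n := by linarith
    have hmn : α * n + θ ∈ Ioi θ := by
      have := mul_pos hα hn0
      show θ < _
      linarith
    have h := hconc.2 (hmem 0) (hmem n) (show 0 ≤ 1 / (n : ℝ) by positivity)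
      (show 0 ≤ ((n : ℝ) - 1) / n from div_nonneg (by linarith) hn0.le) (by field_simp; ring)
    have hx : 1 / (n : ℝ) * (α * ((0 : ℕ) + 1) + θ) + (n - 1) / n * (α * (n + 1) + θ) =
        α * n + θ := by
      push_cast
      field_simp
      ring
    simp only [smul_eq_mul] at h
    rw [hx, add_sub_cancel_right, add_sub_cancel_right, add_sub_cancel_right] at h
    have h0 : 0 < 1 / (n : ℝ) * (F (α * ((0 : ℕ) + 1) + θ) / (α * ((0 : ℕ) + 1))) := by
      have := hφpos _ (hmem 0)
      rw [add_sub_cancel_right] at this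
      exact mul_pos (by positivity) this
    have h1 : (n - 1) / (n : ℝ) * (F (α * (n + 1) + θ) / (α * (n + 1))) ≤
        F (α * n + θ) / (α * n) := by linarith
    have h2 : (n - 1) * F (α * (n + 1) + θ) ≤ (n + 1) * F (α * n + θ) := by
      rw [div_mul_div_comm, div_le_div_iff₀ (by positivity) (by positivity)] at h1
      have : 0 < α * (n : ℝ) := mul_pos hα hn0
      refine le_of_mul_le_mul_left ?_ (mul_pos this one_pos)
      nlinarith
    have h3 : (n : ℝ) + 1 ≤ (n - 1) * (1 + ε) := by
      have := (div_le_iff₀ hε).1 (show 2 / ε ≤ (n : ℝ) - 1 by linarith)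
      linarith
    push_cast
    refine le_of_mul_le_mul_left (h2.trans ?_) (show (0 : ℝ) < n - 1 by linarith)
    nlinarith [mul_le_mul_of_nonneg_right h3 (hpos _ hmn).le]
  have hq : ∀ n, 0 < coeffA (fun u => F (u + θ)) α n :=
    coeffA_pos fun n => hpos _ (hmem n)
  have hmain := tendsto_powerSeries_ratio (T := fun n : ℕ => F (α * n + θ)) (p := coeffA F α)
    (q := coeffA (fun u => F (u + θ)) α) (by simpa using hθroot) hTpos htop hslow hq
    (fun n => by
      rw [coeffA_succ]
      push_cast
      exact inv_mul_cancel_right₀ (hpos _ (hmem n)).ne' _)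
    (div_pos hθpos hα) ((div_lt_one hα).2 hθα).le hC.le hlim
  refine (hmain.comp (tendsto_rpow_atTop hα)).congr' ?_
  filter_upwards [eventually_ge_atTop 0] with x hx
  simp only [Function.comp_apply, Iser]
  rw [← Real.rpow_mul hx, mul_div_cancel₀ _ hα.ne']
end
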